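/- arXiv:2307.06514 — 6 statements merged into one kernel-verified Lean document; each statement's English description precedes it below -/
import Mathlib

section
/- Let A₀ be a finite-dimensional semisimple associative unital ℂ-algebra, let V be a finite-dimensional ℂ-vector space equipped with an (A₀,A₀)-bimodule structure whose left and right actions are ℂ-bilinear, and let C : V × V → A₀ be a ℂ-bilinear map satisfying C(a·b, c) = a·C(b,c) and C(b, c·a) = C(b,c)·a for all a ∈ A₀ and b, c ∈ V. Assume the left kernel of C is zero, i.e. if C(b,c) = 0 for all c ∈ V then b = 0. Let T₀ : A₀ → ℂ be a nondegenerate trace, i.e. a ℂ-linear map with T₀(xy) = T₀(yx) for all x, y ∈ A₀ and such that the bilinear form (x,y) ↦ T₀(xy) on A₀ is nondegenerate. Then the bilinear form (b,c) ↦ T₀(C(b,c)) on V is nondegenerate. -/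
/-- Let `A₀` be a finite-dimensional semisimple ℂ-algebra, `V` a finite-dimensional
ℂ-vector space with an `(A₀,A₀)`-bimodule structure with ℂ-bilinear actions `l`, `r`,
and `C : V × V → A₀` a ℂ-bilinear map of bimodules with zero left kernel.
If `T₀` is a nondegenerate trace on `A₀`, then `(b,c) ↦ T₀(C b c)` is a
nondegenerate bilinear form on `V`. -/
theorem trace_comp_C_nondegenerate
    (A₀ : Type*) [Ring A₀] [Algebra ℂ A₀] [FiniteDimensional ℂ A₀] [IsSemisimpleRing A₀]
    (V : Type*) [AddCommGroup V] [Module ℂ V] [FiniteDimensional ℂ V]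
    (l r : A₀ →ₗ[ℂ] V →ₗ[ℂ] V)
    (hl1 : l 1 = LinearMap.id)
    (hlmul : ∀ a b : A₀, l (a * b) = l a ∘ₗ l b)
    (hr1 : r 1 = LinearMap.id)
    (hrmul : ∀ a b : A₀, r (a * b) = r b ∘ₗ r a)
    (hlr : ∀ a b : A₀, l a ∘ₗ r b = r b ∘ₗ l a)
    (C : V →ₗ[ℂ] V →ₗ[ℂ] A₀)
    (hCl : ∀ (a : A₀) (x y : V), C (l a x) y = a * C x y)
    (hCr : ∀ (a : A₀) (x y : V), C x (r a y) = C x y * a)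
    (hker : ∀ x : V, (∀ y : V, C x y = 0) → x = 0)
    (T₀ : A₀ →ₗ[ℂ] ℂ)
    (hT₀tr : ∀ a b : A₀, T₀ (a * b) = T₀ (b * a))
    (hT₀nd : ∀ a : A₀, (∀ b : A₀, T₀ (a * b) = 0) → a = 0) :
    (∀ x : V, (∀ y : V, T₀ (C x y) = 0) → x = 0) ∧
    (∀ y : V, (∀ x : V, T₀ (C x y) = 0) → y = 0) := by
  let B : V →ₗ[ℂ] Module.Dual ℂ V := C.compr₂ T₀
  have hB_apply : ∀ x y : V, B x y = T₀ (C x y) := fun _ _ => rfl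
  have hleft : ∀ x : V, (∀ y : V, T₀ (C x y) = 0) → x = 0 := by
    intro x hx
    refine hker x fun y => hT₀nd _ fun a => ?_
    rw [← hCr]
    exact hx _
  have hinj : Function.Injective B :=
    (injective_iff_map_eq_zero B).2 fun x hx => hleft x fun y => by
      rw [← hB_apply, hx, LinearMap.zero_apply]
  have hsurj : Function.Surjective B :=
    (LinearMap.injective_iff_surjective_of_finrank_eq_finrank
      Subspace.dual_finrank_eq.symm).1 hinj
  refine ⟨hleft, fun y hy => (Module.forall_dual_apply_eq_zero_iff ℂ y).1 fun φ => ?_⟩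
  obtain ⟨x, rfl⟩ := hsurj φ
  exact hy x
end

section
/- Let A₀ be a finite-dimensional semisimple associative unital ℂ-algebra, let V be a finite-dimensional ℂ-vector space equipped with an (A₀,A₀)-bimodule structure whose left and right actions are ℂ-bilinear, and let C : V × V → A₀ be a ℂ-bilinear map satisfying C(a·b, c) = a·C(b,c) and C(b, c·a) = C(b,c)·a for all a ∈ A₀ and b, c ∈ V. If the left kernel of C is zero (i.e. C(b,c) = 0 for all c implies b = 0), then the right kernel of C is also zero (i.e. C(b,c) = 0 for all b implies c = 0). -/
/-- A finite-dimensional semisimple algebra over an algebraically closed field carries a linear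
functional whose kernel contains no nonzero right ideal. -/
theorem IsSemisimpleRing.exists_linearMap_forall_mul_eq_zero_imp
    (K A : Type*) [Field K] [IsAlgClosed K] [Ring A] [Algebra K A] [FiniteDimensional K A]
    [IsSemisimpleRing A] :
    ∃ φ : A →ₗ[K] K, ∀ b : A, (∀ a : A, φ (b * a) = 0) → b = 0 := by
  obtain ⟨n, d, -, ⟨e⟩⟩ := IsSemisimpleRing.exists_algEquiv_pi_matrix_of_isAlgClosed K A
  refine ⟨(∑ i, Matrix.traceLinearMap (Fin (d i)) K K ∘ₗ LinearMap.proj i) ∘ₗ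
    e.toLinearMap, fun b hb ↦ ?_⟩
  rw [← map_eq_zero_iff e e.injective]
  ext1 i
  refine Matrix.ext_iff_trace_mul_right.mpr fun M ↦ ?_
  have h := hb (e.symm (Pi.single i M))
  rw [LinearMap.comp_apply, LinearMap.sum_apply, Finset.sum_eq_single i] at h
  · simpa using h
  · intro j _ hj
    simp [Pi.single_eq_of_ne hj]
  · simp


/-- Let `A₀` be a finite-dimensional semisimple ℂ-algebra, `V` a finite-dimensional
ℂ-vector space with an `(A₀,A₀)`-bimodule structure with ℂ-bilinear actions `l`, `r`,
and `C : V × V → A₀` a ℂ-bilinear map of bimodules. If the left kernel of `C` is zero,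
then the right kernel of `C` is zero. -/
theorem right_kernel_eq_zero_of_left_kernel_eq_zero
    (A₀ : Type*) [Ring A₀] [Algebra ℂ A₀] [FiniteDimensional ℂ A₀] [IsSemisimpleRing A₀]
    (V : Type*) [AddCommGroup V] [Module ℂ V] [FiniteDimensional ℂ V]
    (l r : A₀ →ₗ[ℂ] V →ₗ[ℂ] V)
    (hl1 : l 1 = LinearMap.id)
    (hlmul : ∀ a b : A₀, l (a * b) = l a ∘ₗ l b)
    (hr1 : r 1 = LinearMap.id)
    (hrmul : ∀ a b : A₀, r (a * b) = r b ∘ₗ r a)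
    (hlr : ∀ a b : A₀, l a ∘ₗ r b = r b ∘ₗ l a)
    (C : V →ₗ[ℂ] V →ₗ[ℂ] A₀)
    (hCl : ∀ (a : A₀) (x y : V), C (l a x) y = a * C x y)
    (hCr : ∀ (a : A₀) (x y : V), C x (r a y) = C x y * a)
    (hker : ∀ x : V, (∀ y : V, C x y = 0) → x = 0) :
    ∀ y : V, (∀ x : V, C x y = 0) → y = 0 := by
  obtain ⟨φ, hφ⟩ := IsSemisimpleRing.exists_linearMap_forall_mul_eq_zero_imp ℂ A₀
  have hinj : Function.Injective (C.compr₂ φ) := by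
    rw [injective_iff_map_eq_zero]
    refine fun x hx ↦ hker x fun y ↦ hφ _ fun a ↦ ?_
    rw [← hCr]
    exact LinearMap.congr_fun hx (r a y)
  have hinj' := LinearMap.flip_injective_iff₁.mpr
    ((LinearMap.injective_iff_surjective_of_finrank_eq_finrank
      Subspace.dual_finrank_eq.symm).mp hinj)
  intro y hy
  refine (injective_iff_map_eq_zero _).mp hinj' y (LinearMap.ext fun x ↦ ?_)
  simp [hy x]
end

section
/- Let 𝒜 be an associative unital ℂ-algebra, T : 𝒜 → ℂ a ℂ-linear map, and g : 𝒜 → 𝒜 a ℂ-linear map such that T(ab) = T(b·g(a)) for all a, b ∈ 𝒜. Assume T has zero kernel in the sense that for every x ∈ 𝒜, if T(cx) = 0 for all c ∈ 𝒜 then x = 0. Then g is multiplicative and unital: g(ab) = g(a)g(b) for all a, b ∈ 𝒜 and g(1) = 1; in particular g is an algebra endomorphism of 𝒜. -/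
/-- If `T : 𝒜 → ℂ` is a `g`-twisted trace (`T(ab) = T(b·g(a))`) with zero kernel
(i.e. `T(c·x) = 0` for all `c` implies `x = 0`), then `g` is multiplicative and
unital, hence an algebra endomorphism of `𝒜`. -/
theorem twisting_map_is_algebra_endomorphism
    (𝒜 : Type*) [Ring 𝒜] [Algebra ℂ 𝒜]
    (T : 𝒜 →ₗ[ℂ] ℂ) (g : 𝒜 →ₗ[ℂ] 𝒜)
    (htr : ∀ a b : 𝒜, T (a * b) = T (b * g a))
    (hker : ∀ x : 𝒜, (∀ c : 𝒜, T (c * x) = 0) → x = 0) :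
    (∀ a b : 𝒜, g (a * b) = g a * g b) ∧ g 1 = 1 := by
  have hext : ∀ x y : 𝒜, (∀ c : 𝒜, T (c * x) = T (c * y)) → x = y := fun x y h =>
    sub_eq_zero.mp (hker _ fun c => by rw [mul_sub, map_sub, h c, sub_self])
  refine ⟨fun a b => hext _ _ fun c => ?_, hext _ _ fun c => ?_⟩
  · calc T (c * g (a * b)) = T (a * (b * c)) := by rw [← htr, mul_assoc]
      _ = T (b * (c * g a)) := by rw [htr, mul_assoc]
      _ = T (c * (g a * g b)) := by rw [htr, mul_assoc]
  · rw [← htr, one_mul, mul_one]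
end

section
/- Let b, c > 0, let w : ℝ → ℝ be a measurable function with 0 ≤ w(x) ≤ c·e^{−b|x|} for all x ∈ ℝ, and let 1 ≤ p < ∞. Let M ∈ ℝ[X] be a nonzero polynomial with M(x) ≥ 0 for all x ∈ ℝ. Then the closure in the real L^p space L^p(ℝ, w) of the set of functions {x ↦ M(x)·S(x)·conj(S(x)) : S ∈ ℂ[X]} is exactly the set of (equivalence classes of) functions that are nonnegative almost everywhere with respect to the measure w(x)dx. -/
open MeasureTheory

open Filter Topology
open scoped ENNReal

/-- Dominated convergence in `L^q`. -/
lemma tendsto_eLpNorm_sub_of_dominated {α : Type*} {m : MeasurableSpace α} {μ : Measure α}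
    {q : ℝ≥0∞} (hq : q ≠ ∞) {u : ℕ → α → ℝ} {f F : α → ℝ}
    (hu : ∀ n, AEStronglyMeasurable (u n) μ) (hF : MemLp F q μ)
    (hbound : ∀ n x, |u n x| ≤ F x) (hlim : ∀ x, Tendsto (fun n => u n x) atTop (𝓝 (f x))) :
    Tendsto (fun n => eLpNorm (f - u n) q μ) atTop (𝓝 0) := by
  rcases eq_or_ne q 0 with rfl | hq0
  · simp
  have hqpos : 0 < q.toReal := ENNReal.toReal_pos hq0 hq
  have hf : AEStronglyMeasurable f μ :=
    aestronglyMeasurable_of_tendsto_ae atTop hu (Eventually.of_forall hlim)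
  have hfF : ∀ x, |f x| ≤ F x := fun x =>
    le_of_tendsto (hlim x).abs (Eventually.of_forall fun n => hbound n x)
  simp only [eLpNorm_eq_lintegral_rpow_enorm_toReal hq0 hq]
  have key : Tendsto (fun n => ∫⁻ x, ‖(f - u n) x‖ₑ ^ q.toReal ∂μ) atTop
      (𝓝 (∫⁻ _, 0 ∂μ)) := by
    refine tendsto_lintegral_of_dominated_convergence'
      (fun x => ‖(2 * F x)‖ₑ ^ q.toReal) (fun n => ((hf.sub (hu n)).enorm.pow_const _))
      (fun n => Eventually.of_forall fun x => ?_) ?_ (Eventually.of_forall fun x => ?_)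
    · refine ENNReal.rpow_le_rpow ?_ hqpos.le
      rw [Real.enorm_eq_ofReal_abs, Real.enorm_eq_ofReal_abs]
      refine ENNReal.ofReal_le_ofReal ?_
      rw [Pi.sub_apply]
      calc |f x - u n x| ≤ |f x| + |u n x| := abs_sub _ _
        _ ≤ 2 * F x := by linarith [hfF x, hbound n x]
        _ ≤ |2 * F x| := le_abs_self _
    · exact (lintegral_rpow_enorm_lt_top_of_eLpNorm_lt_top hq0 hq
        (hF.const_mul 2).eLpNorm_lt_top).ne
    · have h0 : Tendsto (fun n => f x - u n x) atTop (𝓝 0) := by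
        simpa using (hlim x).const_sub (f x)
      have h1 := (ENNReal.continuous_rpow_const (y := q.toReal)).tendsto _ |>.comp h0.enorm
      simpa [Function.comp_def, hqpos] using h1
  rw [lintegral_zero] at key
  have h2 := (ENNReal.continuous_rpow_const (y := 1 / q.toReal)).tendsto _ |>.comp key
  simpa [Function.comp_def, hqpos] using h2

/-- `f` belongs to `L^q` and is an `L^q`-limit of polynomial functions. -/
def IsPolynomialLimit (q : ℝ≥0∞) (ν : Measure ℝ) (f : ℝ → ℝ) : Prop :=
  MemLp f q ν ∧ ∀ ε : ℝ≥0∞, ε ≠ 0 →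
    ∃ P : Polynomial ℝ, eLpNorm (f - fun x => P.eval x) q ν ≤ ε

/-- Bounded measurable functions that multiply polynomials into `L^q`-limits of polynomials. -/
def IsPolynomialMultiplier (q : ℝ≥0∞) (ν : Measure ℝ) (g : ℝ → ℝ) : Prop :=
  Measurable g ∧ (∃ C, ∀ x, |g x| ≤ C) ∧
    ∀ P : Polynomial ℝ, IsPolynomialLimit q ν (g * fun x => P.eval x)

/-- Every polynomial is dominated by `exp (δ|x|)`. -/
lemma Polynomial.exists_abs_eval_le_exp {δ : ℝ} (hδ : 0 < δ) (P : Polynomial ℝ) :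
    ∃ C, 0 ≤ C ∧ ∀ x : ℝ, |P.eval x| ≤ C * Real.exp (δ * |x|) := by
  induction P using Polynomial.induction_on' with
  | add P Q hP hQ =>
    obtain ⟨C, hC, hP⟩ := hP
    obtain ⟨D, hD, hQ⟩ := hQ
    refine ⟨C + D, by positivity, fun x => ?_⟩
    rw [Polynomial.eval_add, add_mul]
    exact (abs_add_le _ _).trans (add_le_add (hP x) (hQ x))
  | monomial n a =>
    refine ⟨|a| * (n.factorial / δ ^ n), by positivity, fun x => ?_⟩
    have h := Real.pow_div_factorial_le_exp (δ * |x|) (by positivity) n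
    rw [div_le_iff₀ (by positivity), mul_pow] at h
    rw [Polynomial.eval_monomial, abs_mul, abs_pow, mul_assoc]
    refine mul_le_mul_of_nonneg_left ?_ (abs_nonneg a)
    rw [div_mul_eq_mul_div, le_div_iff₀ (by positivity)]
    linarith

section PolynomialLimit

variable {q : ℝ≥0∞} {ν : Measure ℝ}

lemma memLp_polynomial_mul_exp {δ : ℝ} (hδ : 0 < δ)
    (hexp : MemLp (fun x : ℝ => Real.exp (2 * δ * |x|)) q ν) (P : Polynomial ℝ) :
    MemLp (fun x : ℝ => |P.eval x| * Real.exp (δ * |x|)) q ν := by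
  obtain ⟨C, hC, hP⟩ := P.exists_abs_eval_le_exp hδ
  refine (hexp.const_mul C).mono' ?_ (Eventually.of_forall fun x => ?_)
  · exact (P.continuous.abs.mul (by fun_prop)).aestronglyMeasurable
  · rw [Real.norm_of_nonneg (by positivity),
      show 2 * δ * |x| = δ * |x| + δ * |x| by ring, Real.exp_add, ← mul_assoc]
    exact mul_le_mul_of_nonneg_right (hP x) (Real.exp_nonneg _)

lemma memLp_polynomial {δ : ℝ} (hδ : 0 < δ)
    (hexp : MemLp (fun x : ℝ => Real.exp (2 * δ * |x|)) q ν) (P : Polynomial ℝ) :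
    MemLp (fun x : ℝ => P.eval x) q ν := by
  refine (memLp_polynomial_mul_exp hδ hexp P).mono' P.continuous.aestronglyMeasurable
    (Eventually.of_forall fun x => ?_)
  rw [Real.norm_eq_abs]
  exact le_mul_of_one_le_right (abs_nonneg _) (Real.one_le_exp (by positivity))

lemma isPolynomialLimit_polynomial {P : Polynomial ℝ} (hP : MemLp (fun x : ℝ => P.eval x) q ν) :
    IsPolynomialLimit q ν fun x => P.eval x :=
  ⟨hP, fun ε _ => ⟨P, by simp⟩⟩

/-- Limits of `L^q`-limits of polynomials are again `L^q`-limits of polynomials. -/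
lemma isPolynomialLimit_of_forall (hq : 1 ≤ q) {f : ℝ → ℝ} (hf : MemLp f q ν)
    (h : ∀ ε : ℝ≥0∞, ε ≠ 0 → ∃ g, IsPolynomialLimit q ν g ∧ eLpNorm (f - g) q ν ≤ ε)
    (hpoly : ∀ P : Polynomial ℝ, MemLp (fun x : ℝ => P.eval x) q ν) :
    IsPolynomialLimit q ν f := by
  refine ⟨hf, fun ε hε => ?_⟩
  have hε2 : ε / 2 ≠ 0 := (ENNReal.half_pos hε).ne'
  obtain ⟨g, ⟨hg, hgP⟩, hfg⟩ := h _ hε2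
  obtain ⟨P, hP⟩ := hgP _ hε2
  refine ⟨P, ?_⟩
  rw [← sub_add_sub_cancel f g]
  refine (eLpNorm_add_le (hf.1.sub hg.1) (hg.1.sub (hpoly P).1) hq).trans ?_
  exact (add_le_add hfg hP).trans_eq (ENNReal.add_halves ε)

lemma IsPolynomialLimit.add (hq : 1 ≤ q) {f g : ℝ → ℝ} (hf : IsPolynomialLimit q ν f)
    (hg : IsPolynomialLimit q ν g)
    (hpoly : ∀ P : Polynomial ℝ, MemLp (fun x : ℝ => P.eval x) q ν) :
    IsPolynomialLimit q ν (f + g) := by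
  refine ⟨hf.1.add hg.1, fun ε hε => ?_⟩
  have hε2 : ε / 2 ≠ 0 := (ENNReal.half_pos hε).ne'
  obtain ⟨P, hP⟩ := hf.2 _ hε2
  obtain ⟨Q, hQ⟩ := hg.2 _ hε2
  refine ⟨P + Q, ?_⟩
  have : (f + g - fun x => (P + Q).eval x)
      = (f - fun x => P.eval x) + (g - fun x => Q.eval x) := by
    ext x; simp; ring
  rw [this]
  refine (eLpNorm_add_le (hf.1.1.sub (hpoly P).1) (hg.1.1.sub (hpoly Q).1) hq).trans ?_
  exact (add_le_add hP hQ).trans_eq (ENNReal.add_halves ε)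

lemma IsPolynomialLimit.of_tendsto (hq : 1 ≤ q) (hq' : q ≠ ∞) {u : ℕ → ℝ → ℝ} {f F : ℝ → ℝ}
    (hu : ∀ n, IsPolynomialLimit q ν (u n)) (hF : MemLp F q ν)
    (hbound : ∀ n x, |u n x| ≤ F x) (hlim : ∀ x, Tendsto (fun n => u n x) atTop (𝓝 (f x)))
    (hpoly : ∀ P : Polynomial ℝ, MemLp (fun x : ℝ => P.eval x) q ν) :
    IsPolynomialLimit q ν f := by
  refine isPolynomialLimit_of_forall hq ?_ (fun ε hε => ?_) hpoly
  · refine hF.mono' (aestronglyMeasurable_of_tendsto_ae atTop (fun n => (hu n).1.1)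
      (Eventually.of_forall hlim)) (Eventually.of_forall fun x => ?_)
    exact le_of_tendsto (hlim x).norm (Eventually.of_forall fun n => hbound n x)
  · have h := tendsto_eLpNorm_sub_of_dominated hq' (fun n => (hu n).1.1) hF hbound hlim
    obtain ⟨n, hn⟩ := (h.eventually_lt_const (pos_iff_ne_zero.2 hε)).exists
    exact ⟨u n, hu n, hn.le⟩

lemma IsPolynomialMultiplier.mul_isPolynomialLimit (hq : 1 ≤ q) {f g : ℝ → ℝ}
    (hg : IsPolynomialMultiplier q ν g) (hf : IsPolynomialLimit q ν f)
    (hpoly : ∀ P : Polynomial ℝ, MemLp (fun x : ℝ => P.eval x) q ν) :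
    IsPolynomialLimit q ν (g * f) := by
  obtain ⟨hgm, ⟨C, hC⟩, hgP⟩ := hg
  have hC0 : 0 ≤ C := (abs_nonneg _).trans (hC 0)
  have hmem : ∀ h : ℝ → ℝ, MemLp h q ν → MemLp (g * h) q ν := fun h hh =>
    hh.of_le_mul (c := C) (hgm.aestronglyMeasurable.mul hh.1) (Eventually.of_forall fun x => by
      rw [Pi.mul_apply, norm_mul]
      exact mul_le_mul_of_nonneg_right (hC x) (norm_nonneg _))
  refine isPolynomialLimit_of_forall hq (hmem f hf.1) (fun ε hε => ?_) hpoly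
  obtain ⟨P, hP⟩ := hf.2 (ε / (ENNReal.ofReal C + 1)) (by
    simpa [ENNReal.div_eq_zero_iff] using hε)
  refine ⟨_, hgP P, ?_⟩
  rw [← mul_sub]
  refine (eLpNorm_le_mul_eLpNorm_of_ae_le_mul (g := f - fun x => P.eval x) (c := C)
    (Eventually.of_forall fun x => ?_) q).trans ?_
  · rw [Pi.mul_apply, norm_mul]
    exact mul_le_mul_of_nonneg_right (hC x) (norm_nonneg _)
  · calc _ ≤ (ENNReal.ofReal C + 1) * (ε / (ENNReal.ofReal C + 1)) := by
          gcongr; exact le_self_add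
      _ ≤ ε := ENNReal.mul_div_le

lemma IsPolynomialMultiplier.mul (hq : 1 ≤ q) {f g : ℝ → ℝ}
    (hf : IsPolynomialMultiplier q ν f) (hg : IsPolynomialMultiplier q ν g)
    (hpoly : ∀ P : Polynomial ℝ, MemLp (fun x : ℝ => P.eval x) q ν) :
    IsPolynomialMultiplier q ν (f * g) := by
  refine ⟨hf.1.mul hg.1, ?_, fun P => ?_⟩
  · obtain ⟨C, hC⟩ := hf.2.1
    obtain ⟨D, hD⟩ := hg.2.1
    refine ⟨C * D, fun x => ?_⟩
    rw [Pi.mul_apply, abs_mul]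
    exact mul_le_mul (hC x) (hD x) (abs_nonneg _) ((abs_nonneg _).trans (hC x))
  · rw [mul_assoc]
    exact hf.mul_isPolynomialLimit hq (hg.2.2 P) hpoly

lemma IsPolynomialMultiplier.add (hq : 1 ≤ q) {f g : ℝ → ℝ}
    (hf : IsPolynomialMultiplier q ν f) (hg : IsPolynomialMultiplier q ν g)
    (hpoly : ∀ P : Polynomial ℝ, MemLp (fun x : ℝ => P.eval x) q ν) :
    IsPolynomialMultiplier q ν (f + g) := by
  refine ⟨hf.1.add hg.1, ?_, fun P => ?_⟩
  · obtain ⟨C, hC⟩ := hf.2.1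
    obtain ⟨D, hD⟩ := hg.2.1
    exact ⟨C + D, fun x => (abs_add_le _ _).trans (add_le_add (hC x) (hD x))⟩
  · rw [add_mul]
    exact (hf.2.2 P).add hq (hg.2.2 P) hpoly

lemma isPolynomialMultiplier_const
    (hpoly : ∀ P : Polynomial ℝ, MemLp (fun x : ℝ => P.eval x) q ν) (a : ℝ) :
    IsPolynomialMultiplier q ν fun _ => a := by
  refine ⟨measurable_const, ⟨|a|, fun _ => le_rfl⟩, fun P => ?_⟩
  have : ((fun _ => a) * fun x => P.eval x) = fun x => (Polynomial.C a * P).eval x := by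
    ext x; simp
  rw [this]
  exact isPolynomialLimit_polynomial (hpoly _)

lemma IsPolynomialMultiplier.polynomial_comp (hq : 1 ≤ q) {g : ℝ → ℝ}
    (hg : IsPolynomialMultiplier q ν g)
    (hpoly : ∀ P : Polynomial ℝ, MemLp (fun x : ℝ => P.eval x) q ν) (Q : Polynomial ℝ) :
    IsPolynomialMultiplier q ν fun x => Q.eval (g x) := by
  induction Q using Polynomial.induction_on with
  | C a => simpa using isPolynomialMultiplier_const hpoly a
  | add P Q hP hQ =>
    simp only [Polynomial.eval_add]
    exact hP.add hq hQ hpoly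
  | monomial n a h =>
    have := h.mul hq hg hpoly
    simpa [pow_succ, mul_assoc, Pi.mul_def] using this

lemma IsPolynomialMultiplier.of_tendsto (hq : 1 ≤ q) (hq' : q ≠ ∞) {u : ℕ → ℝ → ℝ} {f : ℝ → ℝ}
    (hu : ∀ n, IsPolynomialMultiplier q ν (u n)) {C : ℝ}
    (hbound : ∀ n x, |u n x| ≤ C) (hlim : ∀ x, Tendsto (fun n => u n x) atTop (𝓝 (f x)))
    (hpoly : ∀ P : Polynomial ℝ, MemLp (fun x : ℝ => P.eval x) q ν) :
    IsPolynomialMultiplier q ν f := by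
  refine ⟨measurable_of_tendsto_metrizable (fun n => (hu n).1) (tendsto_pi_nhds.2 hlim),
    ⟨C, fun x => le_of_tendsto (hlim x).abs (Eventually.of_forall fun n => hbound n x)⟩,
    fun P => ?_⟩
  refine IsPolynomialLimit.of_tendsto hq hq' (fun n => (hu n).2.2 P)
    ((hpoly P).abs.const_mul C) (fun n x => ?_) (fun x => (hlim x).mul_const _) hpoly
  rw [Pi.mul_apply, abs_mul]
  exact mul_le_mul_of_nonneg_right (hbound n x) (abs_nonneg _)

end PolynomialLimit

section PolynomialDensity

variable {q : ℝ≥0∞} {ν : Measure ℝ}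

lemma abs_sum_sin_series_le (y : ℝ) (N : ℕ) :
    |∑ n ∈ Finset.range N, (-1) ^ n * y ^ (2 * n + 1) / ((2 * n + 1).factorial : ℝ)|
      ≤ Real.exp |y| := by
  calc |∑ n ∈ Finset.range N, (-1) ^ n * y ^ (2 * n + 1) / ((2 * n + 1).factorial : ℝ)|
      ≤ ∑ n ∈ Finset.range N, |y| ^ (2 * n + 1) / ((2 * n + 1).factorial : ℝ) := by
        refine (Finset.abs_sum_le_sum_abs _ _).trans_eq (Finset.sum_congr rfl fun n _ => ?_)
        rw [abs_div, abs_mul, abs_pow, abs_pow, abs_neg, abs_one, one_pow, one_mul, Nat.abs_cast]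
    _ ≤ Real.sinh |y| := sum_le_hasSum _ (fun n _ => by positivity) (Real.hasSum_sinh |y|)
    _ ≤ Real.exp |y| := by
        rw [← Real.cosh_add_sinh]
        linarith [Real.cosh_pos |y|]

lemma isPolynomialMultiplier_sin (hq : 1 ≤ q) (hq' : q ≠ ∞) {δ : ℝ} (hδ : 0 < δ)
    (hexp : MemLp (fun x : ℝ => Real.exp (2 * δ * |x|)) q ν) {t : ℝ} (ht : |t| ≤ δ) :
    IsPolynomialMultiplier q ν fun x => Real.sin (t * x) := by
  have hpoly := memLp_polynomial hδ hexp
  refine ⟨by fun_prop, ⟨1, fun x => Real.abs_sin_le_one _⟩, fun P => ?_⟩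
  refine IsPolynomialLimit.of_tendsto hq hq' (u := fun N x =>
    (∑ n ∈ Finset.range N, (-1) ^ n * (t * x) ^ (2 * n + 1) / ((2 * n + 1).factorial : ℝ))
      * P.eval x) (fun N => ?_) (memLp_polynomial_mul_exp hδ hexp P) (fun N x => ?_)
    (fun x => ((Real.hasSum_sin (t * x)).tendsto_sum_nat).mul_const _) hpoly
  · convert isPolynomialLimit_polynomial (hpoly ((∑ n ∈ Finset.range N,
      Polynomial.C ((-1) ^ n * t ^ (2 * n + 1) / ((2 * n + 1).factorial : ℝ))
        * Polynomial.X ^ (2 * n + 1)) * P)) using 2 with x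
    rw [Polynomial.eval_mul, Polynomial.eval_finsetSum]
    congr 1
    refine Finset.sum_congr rfl fun n _ => ?_
    simp only [Polynomial.eval_mul, Polynomial.eval_C, Polynomial.eval_pow, Polynomial.eval_X]
    ring
  · rw [abs_mul, mul_comm]
    refine mul_le_mul_of_nonneg_left ((abs_sum_sin_series_le _ N).trans ?_) (abs_nonneg _)
    rw [Real.exp_le_exp, abs_mul]
    exact mul_le_mul_of_nonneg_right ht (abs_nonneg x)

/-- Superlevel sets of multipliers have multiplier indicators. -/
lemma IsPolynomialMultiplier.indicator_Ioi (hq : 1 ≤ q) (hq' : q ≠ ∞) {g : ℝ → ℝ}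
    (hg : IsPolynomialMultiplier q ν g)
    (hpoly : ∀ P : Polynomial ℝ, MemLp (fun x : ℝ => P.eval x) q ν) (a : ℝ) :
    IsPolynomialMultiplier q ν ((g ⁻¹' Set.Ioi a).indicator fun _ => 1) := by
  obtain ⟨C, hC⟩ := hg.2.1
  let φ : ℕ → ℝ → ℝ := fun n y => min 1 (n * max 0 (y - a))
  have hφ : ∀ n, Continuous (φ n) := fun n => by fun_prop
  have hφ0 : ∀ n y, |φ n y| ≤ 1 := fun n y => by
    rw [abs_of_nonneg (le_min zero_le_one (by positivity))]
    exact min_le_left _ _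
  choose p hp using fun n : ℕ => exists_polynomial_near_of_continuousOn (-C) C (φ n)
    (hφ n).continuousOn (1 / ((n : ℝ) + 1)) (by positivity)
  have hgC : ∀ x, g x ∈ Set.Icc (-C) C := fun x => abs_le.1 (hC x)
  refine IsPolynomialMultiplier.of_tendsto hq hq' (C := 2)
    (fun n => hg.polynomial_comp hq hpoly (p n)) (fun n x => ?_) (fun x => ?_) hpoly
  · have h1 := (hp n _ (hgC x)).le
    have h2 : 1 / ((n : ℝ) + 1) ≤ 1 := by
      rw [div_le_one (by positivity)]
      linarith [n.cast_nonneg (α := ℝ)]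
    calc |(p n).eval (g x)| = |((p n).eval (g x) - φ n (g x)) + φ n (g x)| := by
          rw [sub_add_cancel]
      _ ≤ 2 := (abs_add_le _ _).trans (by linarith [hφ0 n (g x)])
  · have hdiff : Tendsto (fun n => (p n).eval (g x) - φ n (g x)) atTop (𝓝 0) :=
      squeeze_zero_norm (fun n => (hp n _ (hgC x)).le) tendsto_one_div_add_atTop_nhds_zero_nat
    have hlim : Tendsto (fun n => φ n (g x)) atTop
        (𝓝 ((g ⁻¹' Set.Ioi a).indicator (fun _ => 1) x)) := by
      by_cases hx : a < g x
      · rw [Set.indicator_of_mem (by exact hx)]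
        refine tendsto_const_nhds.congr' ?_
        obtain ⟨N, hN⟩ := exists_nat_gt (1 / (g x - a))
        filter_upwards [eventually_ge_atTop N] with n hn
        have hpos : 0 < g x - a := sub_pos.2 hx
        rw [div_lt_iff₀ hpos] at hN
        have hnN : (N : ℝ) ≤ n := by exact_mod_cast hn
        simp only [φ, max_eq_right hpos.le]
        rw [min_eq_left (hN.le.trans (mul_le_mul_of_nonneg_right hnN hpos.le))]
      · rw [Set.indicator_of_notMem (by exact hx)]
        simp [φ, max_eq_left (sub_nonpos.2 (not_lt.1 hx))]
    simpa using hdiff.add hlim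

/-- The sets whose indicators are multipliers form a `σ`-algebra. -/
@[reducible]
def multiplierMeasurableSpace (hq : 1 ≤ q) (hq' : q ≠ ∞)
    (hpoly : ∀ P : Polynomial ℝ, MemLp (fun x : ℝ => P.eval x) q ν) : MeasurableSpace ℝ :=
  have hcompl : ∀ s : Set ℝ, IsPolynomialMultiplier q ν (s.indicator fun _ => 1) →
      IsPolynomialMultiplier q ν (sᶜ.indicator fun _ => 1) := fun s hs => by
    convert (isPolynomialMultiplier_const hpoly 1).add hq
      ((isPolynomialMultiplier_const hpoly (-1)).mul hq hs hpoly) hpoly using 1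
    ext x
    by_cases hx : x ∈ s <;> simp [hx]
  have hinter : ∀ s t : Set ℝ, IsPolynomialMultiplier q ν (s.indicator fun _ => 1) →
      IsPolynomialMultiplier q ν (t.indicator fun _ => 1) →
      IsPolynomialMultiplier q ν ((s ∩ t).indicator fun _ => 1) := fun s t hs ht => by
    convert hs.mul hq ht hpoly using 1
    ext x
    by_cases hx : x ∈ s <;> by_cases hy : x ∈ t <;> simp [hx, hy]
  { MeasurableSet' := fun s => IsPolynomialMultiplier q ν (s.indicator fun _ => 1)
    measurableSet_empty := by
      simpa using isPolynomialMultiplier_const hpoly 0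
    measurableSet_compl := hcompl
    measurableSet_iUnion := fun s hs => by
      have hacc : ∀ n, IsPolynomialMultiplier q ν ((Set.accumulate s n).indicator fun _ => 1) := by
        intro n
        induction n with
        | zero => simpa using hs 0
        | succ n ih =>
          rw [Set.accumulate_succ, ← compl_compl (Set.accumulate s n ∪ s (n + 1)), Set.compl_union]
          exact hcompl _ (hinter _ _ (hcompl _ ih) (hcompl _ (hs _)))
      refine IsPolynomialMultiplier.of_tendsto hq hq' (C := 1) hacc (fun n x => ?_)
        (fun x => ?_) hpoly
      · by_cases hx : x ∈ Set.accumulate s n <;> simp [hx]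
      · rw [← Set.iUnion_accumulate]
        exact (Set.monotone_accumulate.tendsto_indicator (Set.accumulate s) (fun _ => (1 : ℝ)) x).mono_right
          (pure_le_nhds _) }

/-- A function is measurable as soon as `sin (t * g)` is measurable for all small `t`. -/
lemma measurable_of_measurable_sin_mul {α : Type*} [MeasurableSpace α] {g : α → ℝ} {δ : ℝ}
    (hδ : 0 < δ) (hg : ∀ t : ℝ, |t| ≤ δ → Measurable fun a => Real.sin (t * g a)) :
    Measurable g := by
  refine measurable_of_tendsto_metrizable (f := fun (n : ℕ) a =>
    (δ / ((n : ℝ) + 1))⁻¹ * Real.sin (δ / ((n : ℝ) + 1) * g a)) (fun n => ?_)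
    (tendsto_pi_nhds.2 fun a => ?_)
  · refine (hg _ ?_).const_mul _
    rw [abs_of_nonneg (by positivity)]
    exact div_le_self hδ.le (by linarith [n.cast_nonneg (α := ℝ)])
  · have hd : HasDerivAt (fun y : ℝ => Real.sin (y * g a)) (g a) 0 := by
      simpa using ((hasDerivAt_id (0 : ℝ)).mul_const (g a)).sin
    have hc : Tendsto (fun n : ℕ => δ / ((n : ℝ) + 1)) atTop (𝓝[≠] 0) := by
      refine tendsto_nhdsWithin_iff.2 ⟨?_, Eventually.of_forall fun n => ?_⟩
      · simpa [div_eq_mul_inv] using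
          (tendsto_one_div_add_atTop_nhds_zero_nat (𝕜 := ℝ)).const_mul δ
      · have : 0 < δ / ((n : ℝ) + 1) := by positivity
        exact this.ne'
    have := (hasDerivAt_iff_tendsto_slope_zero.1 hd).comp hc
    simpa [Function.comp_def] using this

/-- Under an exponential moment assumption all Borel indicators are multipliers. -/
lemma isPolynomialMultiplier_indicator (hq : 1 ≤ q) (hq' : q ≠ ∞) {δ : ℝ} (hδ : 0 < δ)
    (hexp : MemLp (fun x : ℝ => Real.exp (2 * δ * |x|)) q ν) {s : Set ℝ} (hs : MeasurableSet s) :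
    IsPolynomialMultiplier q ν (s.indicator fun _ => 1) := by
  have hpoly := memLp_polynomial hδ hexp
  have hid : @Measurable ℝ ℝ (multiplierMeasurableSpace hq hq' hpoly) _ id :=
    @measurable_of_measurable_sin_mul ℝ (multiplierMeasurableSpace hq hq' hpoly) id δ hδ
      fun t ht => @measurable_of_Ioi ℝ ℝ _ _ _ (multiplierMeasurableSpace hq hq' hpoly) _ _ _ _
        fun a => (isPolynomialMultiplier_sin hq hq' hδ hexp ht).indicator_Ioi hq hq' hpoly a
  exact hid hs

/-- Polynomials are dense in `L^q` of a measure with an exponential moment. -/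
theorem exists_polynomial_eLpNorm_sub_le (hq : 1 ≤ q) (hq' : q ≠ ∞) {δ : ℝ} (hδ : 0 < δ)
    (hexp : MemLp (fun x : ℝ => Real.exp (2 * δ * |x|)) q ν) {f : ℝ → ℝ} (hf : MemLp f q ν)
    {ε : ℝ≥0∞} (hε : ε ≠ 0) :
    ∃ P : Polynomial ℝ, eLpNorm (f - fun x => P.eval x) q ν ≤ ε := by
  suffices h : ∃ g : ℝ → ℝ, eLpNorm (f - g) q ν ≤ ε ∧
      ∃ P : Polynomial ℝ, g = fun x => P.eval x by
    obtain ⟨_, h, P, rfl⟩ := h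
    exact ⟨P, h⟩
  refine hf.induction_dense hq' _ (fun c s hs _ ε hε => ?_) ?_ ?_ hε
  · obtain ⟨P, hP⟩ := ((isPolynomialMultiplier_indicator hq hq' hδ hexp hs).2.2
      (Polynomial.C c)).2 ε hε
    refine ⟨_, ?_, P, rfl⟩
    rw [eLpNorm_sub_comm]
    convert hP using 2
    congr 1
    ext x
    by_cases hx : x ∈ s <;> simp [hx]
  · rintro _ _ ⟨P, rfl⟩ ⟨Q, rfl⟩
    exact ⟨P + Q, by ext x; simp⟩
  · rintro _ ⟨P, rfl⟩
    exact P.continuous.aestronglyMeasurable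

end PolynomialDensity

section Squares

variable {p : ℝ} {ν : Measure ℝ}

instance holderTriple_mul_two (q : ℝ≥0∞) :
    ENNReal.HolderTriple (q * ENNReal.ofReal 2) (q * ENNReal.ofReal 2) q where
  inv_add_inv_eq_inv := by
    rw [ENNReal.ofReal_ofNat, ENNReal.mul_inv (by simp) (by simp), ← mul_add,
      ENNReal.inv_two_add_inv_two, mul_one]

/-- Squares of polynomials are dense in the nonnegative part of `L^q`. -/
lemma exists_polynomial_eLpNorm_sub_sq_le {q : ℝ≥0∞} (hq : 1 ≤ q) (hq' : q ≠ ∞) {δ : ℝ}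
    (hδ : 0 < δ) (hexp : MemLp (fun x : ℝ => Real.exp (4 * δ * |x|)) q ν) {f : ℝ → ℝ}
    (hf : MemLp f q ν) (hf0 : ∀ᵐ x ∂ν, 0 ≤ f x) {ε : ℝ≥0∞} (hε : ε ≠ 0) :
    ∃ P : Polynomial ℝ, eLpNorm (f - fun x => P.eval x ^ 2) q ν ≤ ε := by
  set r := q * ENNReal.ofReal 2 with hr
  have hr1 : 1 ≤ r := by
    rw [hr, ENNReal.ofReal_ofNat]
    exact hq.trans (le_mul_of_one_le_right' (by norm_num))
  have hr' : r ≠ ∞ := ENNReal.mul_ne_top hq' ENNReal.ofReal_ne_top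
  have hsq : ∀ h : ℝ → ℝ, AEStronglyMeasurable h ν → MemLp (fun x => h x ^ 2) q ν →
      MemLp h r ν := fun h hm hh => by
    refine ⟨hm, ?_⟩
    have h1 := eLpNorm_norm_rpow (p := q) (μ := ν) h two_pos
    have h2 : (fun x => ‖h x‖ ^ (2 : ℝ)) = fun x => h x ^ 2 := by
      ext x
      rw [Real.rpow_two, Real.norm_eq_abs, sq_abs]
    rw [h2] at h1
    have h3 := hh.2
    rw [h1] at h3
    exact (ENNReal.rpow_lt_top_iff_of_pos two_pos).1 h3
  let g : ℝ → ℝ := fun x => √(f x)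
  have hgf : (fun x => g x ^ 2) =ᵐ[ν] f := by
    filter_upwards [hf0] with x hx using Real.sq_sqrt hx
  have hg : MemLp g r ν := hsq g (Real.continuous_sqrt.comp_aestronglyMeasurable hf.1)
    ((memLp_congr_ae hgf).2 hf)
  have hexp' : MemLp (fun x : ℝ => Real.exp (2 * δ * |x|)) r ν := by
    refine hsq _ (by fun_prop) ?_
    convert hexp using 2 with x
    rw [← Real.exp_nat_mul]
    congr 1
    push_cast
    ring
  let G := eLpNorm g r ν
  have hG : G ≠ ∞ := hg.eLpNorm_ne_top
  obtain ⟨P, hP⟩ := exists_polynomial_eLpNorm_sub_le hr1 hr' hδ hexp' hg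
    (ε := min 1 (ε / (G + G + 1))) (by
      simp [ENNReal.div_eq_zero_iff, hε, hG])
  have hPm := memLp_polynomial hδ hexp' P
  refine ⟨P, ?_⟩
  have hfac : f - (fun x => P.eval x ^ 2) =ᵐ[ν]
      (g - fun x => P.eval x) • (g + g - (g - fun x => P.eval x)) := by
    filter_upwards [hgf] with x hx
    simp only [Pi.sub_apply, Pi.smul_apply', Pi.add_apply, smul_eq_mul]
    rw [← hx]
    ring
  have hdiff := hg.1.sub hPm.1
  have hsum : eLpNorm (g + g - (g - fun x => P.eval x)) r ν ≤ G + G + 1 := by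
    refine (eLpNorm_sub_le (hg.1.add hg.1) hdiff hr1).trans ?_
    exact add_le_add (eLpNorm_add_le hg.1 hg.1 hr1) (hP.trans (min_le_left _ _))
  rw [eLpNorm_congr_ae hfac]
  calc _ ≤ eLpNorm (g - fun x => P.eval x) r ν
          * eLpNorm (g + g - (g - fun x => P.eval x)) r ν :=
        eLpNorm_smul_le_mul_eLpNorm ((hg.1.add hg.1).sub hdiff) hdiff
    _ ≤ ε / (G + G + 1) * (G + G + 1) := mul_le_mul' (hP.trans (min_le_right _ _)) hsum
    _ ≤ ε := by rw [mul_comm]; exact ENNReal.mul_div_le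

lemma eLpNorm_withDensity_rpow {μ : Measure ℝ} (hp : 0 < p) {m : ℝ → ℝ} (hm : Measurable m)
    (hm0 : ∀ x, 0 ≤ m x) (h : ℝ → ℝ) :
    eLpNorm h (ENNReal.ofReal p) (μ.withDensity fun x => ENNReal.ofReal (m x ^ p)) =
      eLpNorm (m * h) (ENNReal.ofReal p) μ := by
  have hp0 : ENNReal.ofReal p ≠ 0 := by simpa using hp
  rw [eLpNorm_eq_lintegral_rpow_enorm_toReal hp0 ENNReal.ofReal_ne_top,
    eLpNorm_eq_lintegral_rpow_enorm_toReal hp0 ENNReal.ofReal_ne_top,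
    lintegral_withDensity_eq_lintegral_mul_non_measurable _ (hm.pow_const p).ennreal_ofReal
      (Eventually.of_forall fun x => ENNReal.ofReal_lt_top)]
  congr 1
  refine lintegral_congr fun x => ?_
  rw [ENNReal.toReal_ofReal hp.le, Pi.mul_apply, Pi.mul_apply, enorm_mul,
    ENNReal.mul_rpow_of_nonneg _ _ hp.le, Real.enorm_of_nonneg (hm0 x),
    ENNReal.ofReal_rpow_of_nonneg (hm0 x) hp.le]

/-- Multiples `M · P²` are dense in the nonnegative part of `L^p`. -/
lemma exists_polynomial_eLpNorm_sub_mul_sq_le {μ : Measure ℝ} (hp : 1 ≤ p) {δ : ℝ}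
    (hδ : 0 < δ) (hexp : MemLp (fun x : ℝ => Real.exp (5 * δ * |x|)) (ENNReal.ofReal p) μ)
    {M : Polynomial ℝ} (hM0 : ∀ x, 0 ≤ M.eval x) (hM : ∀ᵐ x ∂μ, M.eval x ≠ 0)
    {f : ℝ → ℝ} (hf : MemLp f (ENNReal.ofReal p) μ) (hf0 : ∀ᵐ x ∂μ, 0 ≤ f x)
    {ε : ℝ≥0∞} (hε : ε ≠ 0) :
    ∃ P : Polynomial ℝ,
      eLpNorm (f - fun x => M.eval x * P.eval x ^ 2) (ENNReal.ofReal p) μ ≤ ε := by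
  have hp0 : 0 < p := zero_lt_one.trans_le hp
  have hMm : Measurable fun x => M.eval x := M.continuous.measurable
  set ν := μ.withDensity fun x => ENNReal.ofReal (M.eval x ^ p) with hν
  have hac : ν ≪ μ := withDensity_absolutelyContinuous _ _
  have hnorm := fun h => eLpNorm_withDensity_rpow (μ := μ) hp0 hMm hM0 h
  rw [← hν] at hnorm
  have hcancel : ((fun x => M.eval x) * fun x => f x / M.eval x) =ᵐ[μ] f := by
    filter_upwards [hM] with x hx using mul_div_cancel₀ _ hx
  have hfM : MemLp (fun x => f x / M.eval x) (ENNReal.ofReal p) ν := by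
    refine ⟨((hf.1.aemeasurable.div hMm.aemeasurable).aestronglyMeasurable).mono_ac hac, ?_⟩
    rw [hnorm, eLpNorm_congr_ae hcancel]
    exact hf.2
  have hexpM : MemLp (fun x : ℝ => Real.exp (4 * δ * |x|)) (ENNReal.ofReal p) ν := by
    refine ⟨by fun_prop, ?_⟩
    rw [hnorm]
    obtain ⟨C, hC, hMC⟩ := M.exists_abs_eval_le_exp hδ
    refine ((hexp.const_mul C).mono' ?_ (Eventually.of_forall fun x => ?_)).2
    · exact hMm.aestronglyMeasurable.mul (by fun_prop)
    · rw [Pi.mul_apply, norm_mul, Real.norm_of_nonneg (Real.exp_nonneg _),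
        show 5 * δ * |x| = δ * |x| + 4 * δ * |x| by ring, Real.exp_add, ← mul_assoc]
      exact mul_le_mul_of_nonneg_right (hMC x) (Real.exp_nonneg _)
  obtain ⟨P, hP⟩ := exists_polynomial_eLpNorm_sub_sq_le (by simpa using hp)
    ENNReal.ofReal_ne_top hδ hexpM hfM
    (by filter_upwards [hac.ae_le hf0] with x hx using div_nonneg hx (hM0 x)) hε
  refine ⟨P, le_of_eq_of_le ?_ hP⟩
  rw [hnorm]
  refine eLpNorm_congr_ae ?_
  filter_upwards [hcancel] with x hx
  rw [mul_sub, Pi.sub_apply, Pi.sub_apply, hx]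
  rfl

end Squares

lemma integrable_exp_neg_mul_abs {a : ℝ} (ha : 0 < a) :
    Integrable fun x : ℝ => Real.exp (-a * |x|) := by
  rw [← integrableOn_univ, ← Set.Iic_union_Ioi (a := (0 : ℝ)), integrableOn_union]
  constructor
  · refine (integrableOn_exp_mul_Iic ha 0).congr_fun (fun x hx => ?_) measurableSet_Iic
    simp only [abs_of_nonpos (Set.mem_Iic.1 hx)]
    ring_nf
  · refine (integrableOn_exp_mul_Ioi (neg_lt_zero.2 ha) 0).congr_fun (fun x hx => ?_)
      measurableSet_Ioi
    simp only [abs_of_pos (Set.mem_Ioi.1 hx)]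

/-- Measures with an exponentially decaying density have exponential moments. -/
lemma memLp_exp_withDensity {b c p : ℝ} (hb : 0 < b) (hp : 0 < p) {w : ℝ → ℝ}
    (hw_meas : Measurable w) (hw : ∀ x, w x ≤ c * Real.exp (-b * |x|)) :
    MemLp (fun x : ℝ => Real.exp (b / (2 * p) * |x|)) (ENNReal.ofReal p)
      (volume.withDensity fun x => ENNReal.ofReal (w x)) := by
  refine ⟨by fun_prop, ?_⟩
  rw [eLpNorm_lt_top_iff_lintegral_rpow_enorm_lt_top (by simpa using hp) ENNReal.ofReal_ne_top,
    lintegral_withDensity_eq_lintegral_mul_non_measurable _ hw_meas.ennreal_ofReal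
      (Eventually.of_forall fun x => ENNReal.ofReal_lt_top)]
  refine lt_of_le_of_lt (lintegral_mono fun x => ?_)
    ((integrable_exp_neg_mul_abs (half_pos hb)).const_mul c).lintegral_lt_top
  rw [Pi.mul_apply, ENNReal.toReal_ofReal hp.le, Real.enorm_of_nonneg (Real.exp_nonneg _),
    ENNReal.ofReal_rpow_of_nonneg (Real.exp_nonneg _) hp.le, ← Real.exp_mul,
    ← ENNReal.ofReal_mul' (Real.exp_nonneg _)]
  refine ENNReal.ofReal_le_ofReal ?_
  refine (mul_le_mul_of_nonneg_right (hw x) (Real.exp_nonneg _)).trans_eq ?_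
  rw [mul_assoc, ← Real.exp_add]
  congr 2
  field_simp
  ring

/-- Let `w : ℝ → ℝ` be measurable with `0 ≤ w(x) ≤ c·exp(−b|x|)`, `1 ≤ p < ∞`, and let
`M ∈ ℝ[X]` be a nonzero polynomial nonnegative on ℝ. Then the closure in the real
`L^p(ℝ, w)` of the set `{M(x)·S(x)·conj(S(x)) : S ∈ ℂ[X]}` is exactly the set of
almost everywhere nonnegative functions. (The `Fact` instance merely records
`1 ≤ p` at the level of `ℝ≥0∞`, which follows from `hp`, so that the `L^p` space
carries its norm topology.) -/
theorem closure_of_M_times_squares_eq_nonneg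
    (b c : ℝ) (hb : 0 < b) (hc : 0 < c)
    (w : ℝ → ℝ) (hw_meas : Measurable w)
    (hw : ∀ x : ℝ, 0 ≤ w x ∧ w x ≤ c * Real.exp (-b * |x|))
    (p : ℝ) (hp : 1 ≤ p) [Fact (1 ≤ ENNReal.ofReal p)]
    (μ : Measure ℝ) (hμ : μ = volume.withDensity fun x => ENNReal.ofReal (w x))
    (M : Polynomial ℝ) (hM : M ≠ 0) (hMnonneg : ∀ x : ℝ, 0 ≤ M.eval x) :
    closure {f : Lp ℝ (ENNReal.ofReal p) μ |
        ∃ S : Polynomial ℂ,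
          (f : ℝ → ℝ) =ᵐ[μ] fun x : ℝ => M.eval x * Complex.normSq (S.eval (x : ℂ))} =
      {f : Lp ℝ (ENNReal.ofReal p) μ | ∀ᵐ x ∂μ, 0 ≤ f x} := by
  subst hμ
  have hp0 : 0 < p := zero_lt_one.trans_le hp
  set μ := volume.withDensity fun x => ENNReal.ofReal (w x)
  have hδ : 0 < b / (10 * p) := by positivity
  have hexp : MemLp (fun x : ℝ => Real.exp (5 * (b / (10 * p)) * |x|)) (ENNReal.ofReal p) μ := by
    convert memLp_exp_withDensity hb hp0 hw_meas (fun x => (hw x).2) using 4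
    field_simp
    norm_num
  have hexp2 : MemLp (fun x : ℝ => Real.exp (2 * (b / (10 * p)) * |x|)) (ENNReal.ofReal p) μ := by
    refine hexp.mono' (by fun_prop) (Eventually.of_forall fun x => ?_)
    rw [Real.norm_of_nonneg (Real.exp_nonneg _), Real.exp_le_exp]
    gcongr
    norm_num
  have hMae : ∀ᵐ x ∂μ, M.eval x ≠ 0 := by
    refine (withDensity_absolutelyContinuous _ _).ae_le ?_
    refine measure_mono_null (fun x hx => ?_) (M.roots.toFinset.finite_toSet.measure_zero volume)
    simpa [hM] using hx
  have hset : {f : Lp ℝ (ENNReal.ofReal p) μ | ∀ᵐ x ∂μ, 0 ≤ f x} = Set.Ici 0 := by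
    ext f
    exact Lp.coeFn_nonneg f
  refine Set.Subset.antisymm (closure_minimal ?_ (hset ▸ isClosed_Ici)) fun f hf => ?_
  · rintro f ⟨S, hS⟩
    filter_upwards [hS] with x hx
    rw [hx]
    exact mul_nonneg (hMnonneg x) (Complex.normSq_nonneg _)
  · refine EMetric.mem_closure_iff.2 fun ε hε => ?_
    obtain ⟨ε', hε', hεε'⟩ := exists_between hε
    obtain ⟨P, hP⟩ := exists_polynomial_eLpNorm_sub_mul_sq_le hp hδ hexp hMnonneg hMae
      (Lp.memLp f) hf hε'.ne'
    have hmem : MemLp (fun x : ℝ => M.eval x * P.eval x ^ 2) (ENNReal.ofReal p) μ :=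
      (memLp_congr_ae (Eventually.of_forall fun x => by
        rw [Polynomial.eval_mul, Polynomial.eval_pow])).1 (memLp_polynomial hδ hexp2 (M * P ^ 2))
    refine ⟨hmem.toLp _, ⟨P.map (algebraMap ℝ ℂ), ?_⟩, ?_⟩
    · filter_upwards [hmem.coeFn_toLp] with x hx
      rw [hx, ← Complex.coe_algebraMap, Polynomial.eval_map_apply, Complex.coe_algebraMap,
        Complex.normSq_ofReal, sq]
    · rw [Lp.edist_def, eLpNorm_congr_ae (Filter.EventuallyEq.rfl.sub hmem.coeFn_toLp)]
      exact hP.trans_lt hεε'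
end

section
/- Let a ∈ ℝ, t ∈ ℂ, P ∈ ℂ[X], and let w : ℂ → ℂ satisfy w(z+1) = t·w(z) for all z ∈ ℂ. Assume: (i) the function z ↦ P(z − 1/2)·w(z) is complex-differentiable on an open set containing the closed strip {z ∈ ℂ : a ≤ Re z ≤ a+1}; (ii) there exist constants C, b > 0 such that |P(z − 1/2)·w(z)| ≤ C·e^{−b|Im z|} for all z in that strip; (iii) w is continuous on the line {z : Re z = a} and |w(a+iy)| ≤ C·e^{−b|y|} for all y ∈ ℝ. Then for every polynomial S ∈ ℂ[X]: ∫_ℝ S(a+iy−1/2)·P(a+iy−1/2)·w(a+iy) dy = t·∫_ℝ S(a+iy+1/2)·P(a+iy+1/2)·w(a+iy) dy. (Equivalently, the linear functional T(R) = ∫_{a+iℝ} R(z)·w(z) dz on ℂ[X] satisfies the twisted trace relation T(S(z−1/2)·P(z−1/2)) = t·T(S(z+1/2)·P(z+1/2)) for all S.) -/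
open Complex

/-- On a closed vertical strip, a polynomial grows slower than any exponential of `|Im z|`. -/
lemma Polynomial.exists_norm_eval_le_exp_on_strip (p : Polynomial ℂ) (a c : ℝ) {ε : ℝ}
    (hε : 0 < ε) :
    ∃ D : ℝ, 0 ≤ D ∧ ∀ z : ℂ, a ≤ z.re → z.re ≤ c →
      ‖p.eval z‖ ≤ D * Real.exp (ε * |z.im|) := by
  induction p using Polynomial.induction_on generalizing ε with
  | C k =>
    refine ⟨‖k‖, norm_nonneg k, fun z _ _ => ?_⟩
    rw [Polynomial.eval_C]
    exact le_mul_of_one_le_right (norm_nonneg k) (Real.one_le_exp (by positivity))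
  | add p q hp hq =>
    obtain ⟨D, hD, hpD⟩ := hp hε
    obtain ⟨E, hE, hqE⟩ := hq hε
    refine ⟨D + E, by positivity, fun z h1 h2 => ?_⟩
    rw [Polynomial.eval_add, add_mul]
    exact (norm_add_le _ _).trans (add_le_add (hpD z h1 h2) (hqE z h1 h2))
  | monomial n k ih =>
    obtain ⟨D, hD, hpD⟩ := ih (half_pos hε)
    refine ⟨D * (|a| + |c| + 2 / ε), by positivity, fun z h1 h2 => ?_⟩
    have hz : ‖z‖ ≤ (|a| + |c| + 2 / ε) * Real.exp (ε / 2 * |z.im|) := by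
      have hre : |z.re| ≤ |a| + |c| := by
        rw [abs_le]
        constructor
        · linarith [neg_abs_le a, abs_nonneg c]
        · linarith [le_abs_self c, abs_nonneg a]
      have him : |z.im| ≤ 2 / ε * Real.exp (ε / 2 * |z.im|) := by
        have h := Real.add_one_le_exp (ε / 2 * |z.im|)
        calc |z.im| = 2 / ε * (ε / 2 * |z.im|) := by field_simp
          _ ≤ _ := by gcongr; linarith
      have h := Complex.norm_le_abs_re_add_abs_im z
      have h1 : |a| + |c| ≤ (|a| + |c|) * Real.exp (ε / 2 * |z.im|) :=
        le_mul_of_one_le_right (by positivity) (Real.one_le_exp (by positivity))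
      linarith
    have hexp : Real.exp (ε * |z.im|) =
        Real.exp (ε / 2 * |z.im|) * Real.exp (ε / 2 * |z.im|) := by
      rw [← Real.exp_add]; ring_nf
    rw [pow_succ, ← mul_assoc, Polynomial.eval_mul, Polynomial.eval_X, norm_mul, hexp]
    calc _ ≤ (D * Real.exp (ε / 2 * |z.im|)) *
          ((|a| + |c| + 2 / ε) * Real.exp (ε / 2 * |z.im|)) :=
          mul_le_mul (hpD z h1 h2) hz (norm_nonneg _) (by positivity)
      _ = _ := by ring

lemma integrable_exp_neg_mul_abs_s7 {b : ℝ} (hb : 0 < b) :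
    MeasureTheory.Integrable fun y : ℝ => Real.exp (-b * |y|) := by
  rw [← MeasureTheory.integrableOn_univ, ← Set.Iic_union_Ioi (a := (0 : ℝ))]
  refine MeasureTheory.IntegrableOn.union ?_ ?_
  · refine (integrableOn_exp_mul_Iic hb 0).congr_fun (fun y hy => ?_) measurableSet_Iic
    simp only [abs_of_nonpos (Set.mem_Iic.mp hy), neg_mul_neg]
  · refine (integrableOn_exp_mul_Ioi (neg_lt_zero.mpr hb) 0).congr_fun (fun y hy => ?_)
      measurableSet_Ioi
    simp only [abs_of_pos (Set.mem_Ioi.mp hy)]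

/-- Vertical contour shift: the integrals of a holomorphic function that decays exponentially
on a closed vertical strip agree on the two boundary lines. -/
lemma integral_vertical_line_eq_of_exp_decay {f : ℂ → ℂ} {a c B b : ℝ} (hac : a ≤ c)
    (hb : 0 < b) (hf : DifferentiableOn ℂ f {z : ℂ | a ≤ z.re ∧ z.re ≤ c})
    (hfB : ∀ z : ℂ, a ≤ z.re → z.re ≤ c → ‖f z‖ ≤ B * Real.exp (-b * |z.im|)) :
    ∫ y : ℝ, f (a + y * I) = ∫ y : ℝ, f (c + y * I) := by
  have hint : ∀ x : ℝ, a ≤ x → x ≤ c → MeasureTheory.Integrable fun y : ℝ => f (x + y * I) := by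
    intro x h1 h2
    have hexp : MeasureTheory.Integrable fun y : ℝ => B * Real.exp (-b * |y|) :=
      (integrable_exp_neg_mul_abs_s7 hb).const_mul B
    have hcont : Continuous fun y : ℝ => f (x + y * I) :=
      hf.continuousOn.comp_continuous (by fun_prop) fun y => by simp [h1, h2]
    refine hexp.mono' hcont.aestronglyMeasurable (.of_forall fun y => ?_)
    simpa using hfB (x + y * I) (by simpa using h1) (by simpa using h2)
  have htend : ∀ x : ℝ, a ≤ x → x ≤ c →
      Filter.Tendsto (fun T : ℝ => ∫ y : ℝ in -T..T, f (x + y * I)) Filter.atTop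
        (nhds (∫ y : ℝ, f (x + y * I))) := fun x h1 h2 =>
    MeasureTheory.intervalIntegral_tendsto_integral (hint x h1 h2)
      Filter.tendsto_neg_atTop_atBot Filter.tendsto_id
  have hdecay : Filter.Tendsto (fun T : ℝ => B * Real.exp (-b * |T|) * |c - a|)
      Filter.atTop (nhds 0) := by
    have h : Filter.Tendsto (fun T : ℝ => -b * |T|) Filter.atTop Filter.atBot :=
      Filter.tendsto_abs_atTop_atTop.const_mul_atTop_of_neg (neg_lt_zero.mpr hb)
    simpa using ((Real.tendsto_exp_atBot.comp h).const_mul B).mul_const |c - a|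
  have hbound : ∀ T : ℝ, ‖∫ x : ℝ in a..c, f (x + T * I)‖ ≤ B * Real.exp (-b * |T|) * |c - a| := by
    refine fun T => intervalIntegral.norm_integral_le_of_norm_le_const fun x hx => ?_
    rw [Set.uIoc_of_le hac] at hx
    simpa using hfB (x + T * I) (by simpa using hx.1.le) (by simpa using hx.2)
  have htop : Filter.Tendsto (fun T : ℝ => ∫ x : ℝ in a..c, f (x + T * I)) Filter.atTop
      (nhds 0) := squeeze_zero_norm hbound hdecay
  have hbot : Filter.Tendsto (fun T : ℝ => ∫ x : ℝ in a..c, f (x + (-T : ℝ) * I)) Filter.atTop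
      (nhds 0) := squeeze_zero_norm (fun T => by simpa only [abs_neg] using hbound (-T)) hdecay
  have hrect : ∀ T : ℝ, (∫ x : ℝ in a..c, f (x + (-T : ℝ) * I)) -
      (∫ x : ℝ in a..c, f (x + T * I)) + I * (∫ y : ℝ in -T..T, f (c + y * I)) -
      I * (∫ y : ℝ in -T..T, f (a + y * I)) = 0 := by
    intro T
    have h := integral_boundary_rect_eq_zero_of_differentiableOn f ⟨a, -T⟩ ⟨c, T⟩
      (hf.mono fun z hz => by
        have := hz.1
        rwa [Set.mem_preimage, Set.uIcc_of_le hac] at this)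
    exact h
  have hlim := ((hbot.sub htop).add ((htend c hac le_rfl).const_mul I)).sub
    ((htend a le_rfl hac).const_mul I)
  simp only [hrect] at hlim
  have h := tendsto_nhds_unique hlim tendsto_const_nhds
  rw [sub_zero, zero_add, ← mul_sub, mul_eq_zero, or_iff_right I_ne_zero, sub_eq_zero] at h
  exact h.symm

/-- Contour-shift identity: if `w(z+1) = t·w(z)`, `P(z−1/2)·w(z)` is holomorphic on a
neighborhood of the strip `a ≤ Re z ≤ a+1` with exponential decay, and `w` is
continuous with exponential decay on the line `Re z = a`, then the functional
`T(R) = ∫_{a+iℝ} R(z)·w(z) dz` satisfies the twisted trace relation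
`T(S(z−1/2)·P(z−1/2)) = t·T(S(z+1/2)·P(z+1/2))` for every polynomial `S`. -/
theorem twisted_trace_relation_on_vertical_line
    (a : ℝ) (t : ℂ) (P : Polynomial ℂ) (w : ℂ → ℂ)
    (hw : ∀ z : ℂ, w (z + 1) = t * w z)
    (C b : ℝ) (hC : 0 < C) (hb : 0 < b)
    (hol : ∃ U : Set ℂ, IsOpen U ∧ {z : ℂ | a ≤ z.re ∧ z.re ≤ a + 1} ⊆ U ∧
      DifferentiableOn ℂ (fun z => P.eval (z - 1/2) * w z) U)
    (hdecay : ∀ z : ℂ, a ≤ z.re → z.re ≤ a + 1 →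
      ‖P.eval (z - 1/2) * w z‖ ≤ C * Real.exp (-b * |z.im|))
    (hwcont : ContinuousOn w {z : ℂ | z.re = a})
    (hwdecay : ∀ y : ℝ, ‖w ((a : ℂ) + y * I)‖ ≤ C * Real.exp (-b * |y|)) :
    ∀ S : Polynomial ℂ,
      (∫ y : ℝ, S.eval ((a : ℂ) + y * I - 1/2) * P.eval ((a : ℂ) + y * I - 1/2) *
          w ((a : ℂ) + y * I)) =
        t * ∫ y : ℝ, S.eval ((a : ℂ) + y * I + 1/2) * P.eval ((a : ℂ) + y * I + 1/2) *
          w ((a : ℂ) + y * I) := by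
  intro S
  obtain ⟨U, -, hU, hdiff⟩ := hol
  obtain ⟨D, hD, hSD⟩ := (S.comp (.X - .C (1 / 2))).exists_norm_eval_le_exp_on_strip a (a + 1)
    (half_pos hb)
  have hS : ∀ z : ℂ, (S.comp (.X - .C (1 / 2))).eval z = S.eval (z - 1 / 2) := by simp
  have hshift := integral_vertical_line_eq_of_exp_decay (a := a) (c := a + 1) (B := D * C)
    (f := fun z => S.eval (z - 1 / 2) * (P.eval (z - 1 / 2) * w z)) (by linarith) (half_pos hb)
    (DifferentiableOn.mul (by simpa only [hS] using
      (S.comp (.X - .C (1 / 2))).differentiable.differentiableOn) (hdiff.mono hU))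
    (fun z h1 h2 => by
      have hexp : Real.exp (-(b / 2) * |z.im|) =
          Real.exp (b / 2 * |z.im|) * Real.exp (-b * |z.im|) := by
        rw [← Real.exp_add]; ring_nf
      rw [norm_mul, hexp, ← hS]
      calc _ ≤ (D * Real.exp (b / 2 * |z.im|)) * (C * Real.exp (-b * |z.im|)) :=
            mul_le_mul (hSD z h1 h2) (hdecay z h1 h2) (norm_nonneg _) (by positivity)
        _ = _ := by ring)
  simp only [← mul_assoc] at hshift
  rw [hshift, ← MeasureTheory.integral_const_mul]
  congr 1 with y
  have hw' : w (((a + 1 : ℝ) : ℂ) + y * I) = t * w (a + y * I) := by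
    rw [← hw]; push_cast; ring_nf
  have hz : ((a + 1 : ℝ) : ℂ) + y * I - 1 / 2 = a + y * I + 1 / 2 := by
    push_cast; ring
  rw [hw', hz]
  ring
end

section
/- Let G : ℝ → ℝ be a continuous 2π-periodic function. Suppose that for every complex Laurent polynomial S the integral ∫₀^{2π} S(e^{iθ})·conj(S(e^{iθ}))·G(θ) dθ is nonnegative. Then G(θ) ≥ 0 for every θ ∈ ℝ. -/
/-- Evaluation of a Laurent polynomial (a finitely supported family of coefficients
indexed by ℤ) at a complex number. -/
noncomputable def laurentEval (f : ℤ →₀ ℂ) (z : ℂ) : ℂ :=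
  f.sum fun k a => a * z ^ k

/-- A Laurent polynomial on the unit circle is the corresponding combination of the monomials
`fourier n` on `AddCircle (2 * π)`. -/
theorem finsupp_sum_smul_fourier_apply (c : ℤ →₀ ℂ) (θ : ℝ) :
    (c.sum fun n a => a • (fourier n : C(AddCircle (2 * Real.pi), ℂ))) (θ : AddCircle (2 * Real.pi)) =
      laurentEval c (Complex.exp (θ * Complex.I)) := by
  have hpi : (Real.pi : ℂ) ≠ 0 := Complex.ofReal_ne_zero.mpr Real.pi_ne_zero
  simp only [laurentEval, Finsupp.sum, ContinuousMap.coe_sum, Finset.sum_apply,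
    ContinuousMap.coe_smul, Pi.smul_apply, smul_eq_mul, fourier_coe_apply, ← Complex.exp_int_mul]
  refine Finset.sum_congr rfl fun n _ => ?_
  congr 2
  push_cast
  field_simp

/-- Nonnegativity of the weighted integrals of squared absolute values extends from Laurent
polynomials to all continuous functions on the circle. -/
theorem integral_normSq_mul_nonneg_of_laurent (G : ℝ → ℝ) (hG : Continuous G)
    (hpos : ∀ S : ℤ →₀ ℂ,
      0 ≤ ∫ θ in (0 : ℝ)..(2 * Real.pi),
        Complex.normSq (laurentEval S (Complex.exp (θ * Complex.I))) * G θ)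
    (f : C(AddCircle (2 * Real.pi), ℂ)) :
    0 ≤ ∫ θ in (0 : ℝ)..(2 * Real.pi), Complex.normSq (f (θ : AddCircle (2 * Real.pi))) * G θ := by
  have : Fact (0 < 2 * Real.pi) := ⟨Real.two_pi_pos⟩
  have hcont : Continuous fun f : C(AddCircle (2 * Real.pi), ℂ) =>
      ∫ θ in (0 : ℝ)..(2 * Real.pi), Complex.normSq (f (θ : AddCircle (2 * Real.pi))) * G θ := by
    apply intervalIntegral.continuous_parametric_intervalIntegral_of_continuous'
    have hcoe : Continuous fun θ : ℝ => (θ : AddCircle (2 * Real.pi)) :=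
      AddCircle.continuous_mk' _
    have heval : Continuous fun p : C(AddCircle (2 * Real.pi), ℂ) × ℝ =>
        p.1 (p.2 : AddCircle (2 * Real.pi)) :=
      continuous_fst.eval (hcoe.comp continuous_snd)
    exact (Complex.continuous_normSq.comp heval).mul (hG.comp continuous_snd)
  have hf : f ∈ (Submodule.span ℂ (Set.range (fourier (T := 2 * Real.pi)))).topologicalClosure := by
    rw [span_fourier_closure_eq_top]
    trivial
  refine closure_minimal ?_ (isClosed_Ici.preimage hcont) hf
  intro g hg
  obtain ⟨c, rfl⟩ := Finsupp.mem_span_range_iff_exists_finsupp.mp hg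
  simp only [Set.mem_preimage, Set.mem_Ici, finsupp_sum_smul_fourier_apply]
  exact hpos c

/-- Let `G : ℝ → ℝ` be continuous and 2π-periodic. If for every complex Laurent
polynomial `S` the integral `∫₀^{2π} S(e^{iθ})·conj(S(e^{iθ}))·G(θ) dθ
= ∫₀^{2π} |S(e^{iθ})|²·G(θ) dθ` is nonnegative, then `G ≥ 0` everywhere. -/
theorem periodic_weight_nonneg_of_laurent_integrals_nonneg
    (G : ℝ → ℝ) (hG : Continuous G) (hper : ∀ θ : ℝ, G (θ + 2 * Real.pi) = G θ)
    (hpos : ∀ S : ℤ →₀ ℂ,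
      0 ≤ ∫ θ in (0 : ℝ)..(2 * Real.pi),
        Complex.normSq (laurentEval S (Complex.exp (θ * Complex.I))) * G θ) :
    ∀ θ : ℝ, 0 ≤ G θ := by
  have hper' : Function.Periodic (fun θ => ((√(max (-G θ) 0) : ℝ) : ℂ)) (2 * Real.pi) := by
    intro θ
    simp only [hper]
  have hcont : Continuous fun θ => ((√(max (-G θ) 0) : ℝ) : ℂ) := by fun_prop
  have hint := integral_normSq_mul_nonneg_of_laurent G hG hpos
    ⟨hper'.lift, continuous_coinduced_dom.mpr hcont⟩
  have hsq : ∀ θ, Complex.normSq ((√(max (-G θ) 0) : ℝ) : ℂ) * G θ = -(max (-G θ) 0) ^ 2 := by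
    intro θ
    rw [Complex.normSq_ofReal, Real.mul_self_sqrt (le_max_right _ _)]
    rcases max_cases (-G θ) 0 with ⟨h, _⟩ | ⟨h, _⟩ <;> rw [h] <;> ring
  simp only [ContinuousMap.coe_mk, Function.Periodic.lift_coe, hsq,
    intervalIntegral.integral_neg] at hint
  have hG' : Continuous fun θ => (max (-G θ) 0) ^ 2 := by fun_prop
  intro θ
  obtain ⟨x, hx, hxθ⟩ := Function.Periodic.exists_mem_Ico₀ hper Real.two_pi_pos θ
  rw [hxθ]
  by_contra! hneg
  have : 0 < ∫ θ in (0 : ℝ)..(2 * Real.pi), (max (-G θ) 0) ^ 2 :=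
    intervalIntegral.integral_pos Real.two_pi_pos hG'.continuousOn (fun _ _ => sq_nonneg _)
      ⟨x, Set.Ico_subset_Icc_self hx, pow_pos (lt_max_of_lt_left (neg_pos.mpr hneg)) 2⟩
  linarith
end
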